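/- Let k be a field, A and H associative unital k-algebras, α : A → H a k-algebra homomorphism, ε : H → A a k-linear map satisfying ε(α(a)) = a for all a ∈ A and ε(h h') = ε(h α(ε(h'))) for all h, h' ∈ H, and S : H → H a k-algebra anti-homomorphism. Then the formula (h · f)(a) := f(ε(S(h) α(a))), for h ∈ H, f ∈ Hom_k(A, k), a ∈ A, defines a left H-module structure on the dual vector space A* = Hom_k(A, k). -/

import Mathlib

/-- Let `k` be a field, `A`, `H` associative unital
`k`-algebras, `α : A → H` a `k`-algebra homomorphism and `ε : H → A` a
`k`-linear map with `ε (α a) = a` and `ε (h * h') = ε (h * α (ε h'))`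
(so `h • a := ε (h * α a)` is the bialgebroid action of `H` on `A`), and let
`S : H → H` be a `k`-algebra anti-homomorphism.  Then
`(h • f) a := f (ε (S h * α a))`, i.e. `(h • f) a = f (S h • a)`, defines a
left `H`-module structure on the dual vector space `A* = Hom_k(A, k)`. -/
theorem dualising_object_module_structure (k A H : Type*) [Field k] [Ring A]
    [Algebra k A] [Ring H] [Algebra k H]
    (α : A →ₐ[k] H) (ε : H →ₗ[k] A)
    (hεα : ∀ a : A, ε (α a) = a)
    (hcounit : ∀ h h' : H, ε (h * h') = ε (h * α (ε h')))
    (S : H →ₗ[k] H) (hS1 : S 1 = 1)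
    (hSanti : ∀ h h' : H, S (h * h') = S h' * S h) :
    ∃ inst : Module H (A →ₗ[k] k),
      ∀ (h : H) (f : A →ₗ[k] k) (a : A),
        (inst.toDistribMulAction.toMulAction.toSMul.smul h f) a
          = f (ε (S h * α a)) := by
  refine ⟨
    { smul := fun h f => f ∘ₗ ε ∘ₗ LinearMap.mulLeft k (S h) ∘ₗ α.toLinearMap
      one_smul := fun f => LinearMap.ext fun a => ?_
      mul_smul := fun h h' f => LinearMap.ext fun a => ?_
      smul_zero := fun h => LinearMap.zero_comp _
      smul_add := fun h f g => LinearMap.add_comp _ _ _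
      add_smul := fun h h' f => LinearMap.ext fun a => ?_
      zero_smul := fun f => LinearMap.ext fun a => ?_ }, fun _ _ _ => rfl⟩
  · change f (ε (S (h * h') * α a)) = f (ε (S h' * α (ε (S h * α a))))
    rw [hSanti, mul_assoc, hcounit]
  · change f (ε (S 1 * α a)) = f a
    rw [hS1, one_mul, hεα]
  · change f (ε (S (h + h') * α a)) = f (ε (S h * α a)) + f (ε (S h' * α a))
    rw [map_add, add_mul, map_add, map_add]
  · change f (ε (S 0 * α a)) = 0
    rw [map_zero, zero_mul, map_zero, map_zero]
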